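/- Let d = mJ with m > 1, let W ⊂ ℤ_m with |W| = L < m, let Ω = ∪_{r∈W} (mℤ_d + r) ⊂ ℤ_d, and let Y = {e_i, A e_i, …, A^{m−1} e_i : i ∈ Ω}. Then: (1) if W = {0, 1, …, L−1}, then Y is a frame for ℓ²(ℤ_d) for every A ∈ ℬ_L; (2) if m is prime, then Y is a frame for ℓ²(ℤ_d) for every A ∈ ℬ_L; (3) if m is a power of a prime and W is uniformly distributed over the divisors of m, then Y is a frame for ℓ²(ℤ_d) for every A ∈ ℬ_L. -/

import Mathlib

open Matrix

/-- Unnormalized discrete Fourier transform of `a : ZMod d → ℂ`. -/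
noncomputable def hatKer (d : ℕ) [NeZero d] (a : ZMod d → ℂ) : ZMod d → ℂ :=
  fun j => ∑ k : ZMod d,
    a k * Complex.exp (-(2 * (Real.pi : ℂ) * Complex.I) * ((j.val : ℂ) * (k.val : ℂ)) / (d : ℂ))

/-- The circular convolution operator with kernel `a`, as a matrix. -/
def convMat (d : ℕ) (a : ZMod d → ℂ) : Matrix (ZMod d) (ZMod d) ℂ :=
  Matrix.of fun k i => a (k - i)

/-- The normalized discrete Fourier matrix `F_d`. -/
noncomputable def FdMat (d : ℕ) : Matrix (ZMod d) (ZMod d) ℂ :=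
  Matrix.of fun j k =>
    ((Real.sqrt d : ℝ) : ℂ)⁻¹ *
      Complex.exp (-(2 * (Real.pi : ℂ) * Complex.I) * ((j.val : ℂ) * (k.val : ℂ)) / (d : ℂ))

/-- With `d = mJ` and `a_k = (â(k), â(k+J), …, â(k+(m-1)J))`, this is
`max_{k<J} M_{D_k}`, the largest number of equal entries among the `a_k`'s. -/
noncomputable def maxMultB (d m J : ℕ) [NeZero d] (b : ZMod d → ℂ) : ℕ :=
  (Finset.range J).sup fun k =>
    (Finset.range m).sup fun t =>
      Nat.card {s : ℕ | s < m ∧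
        b (((k + s * J : ℕ) : ZMod d)) = b (((k + t * J : ℕ) : ZMod d))}

/-- `W ⊂ ℤ_m` is uniformly distributed over the divisors of `m`: for every divisor `n`
of `m`, each of the `n` cosets of the subgroup generated by `n` meets `W` in a set of
size `⌊|W|/n⌋` or `⌈|W|/n⌉`. -/
def UnifDist (m : ℕ) (W : Finset (ZMod m)) : Prop :=
  ∀ n : ℕ, n ∣ m → ∀ c : ZMod m,
    {x : ZMod m | x ∈ W ∧ x - c ∈ AddSubgroup.zmultiples ((n : ZMod m))}.ncard = W.card / n
    ∨ {x : ZMod m | x ∈ W ∧ x - c ∈ AddSubgroup.zmultiples ((n : ZMod m))}.ncard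
        = (W.card + n - 1) / n

open Polynomial in
noncomputable def newtQ {R : Type*} [CommRing R] (z : ℕ → R) (f : R[X]) : ℕ → R[X]
  | 0 => f
  | k + 1 => newtQ z f k /ₘ (X - C (z k))

open Polynomial in
lemma newtQ_sum {R : Type*} [CommRing R] (z : ℕ → R) (f : R[X]) (n : ℕ) :
    f = ∑ k ∈ Finset.range n, C ((newtQ z f k).eval (z k)) * ∏ i ∈ Finset.range k, (X - C (z i))
      + newtQ z f n * ∏ i ∈ Finset.range n, (X - C (z i)) := by
  induction n with
  | zero => simp [newtQ]
  | succ n ih =>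
    have h := modByMonic_add_div (newtQ z f n) (X - C (z n))
    rw [modByMonic_X_sub_C_eq_C_eval] at h
    rw [Finset.sum_range_succ, Finset.prod_range_succ]
    conv_lhs => rw [ih]
    rw [newtQ]
    linear_combination (∏ i ∈ Finset.range n, (X - C (z i))) * (-h)

open Polynomial in
lemma newtQ_map {R S : Type*} [CommRing R] [CommRing S] (φ : R →+* S) (z : ℕ → R) (f : R[X])
    (n : ℕ) : (newtQ z f n).map φ = newtQ (fun i => φ (z i)) (f.map φ) n := by
  induction n with
  | zero => simp [newtQ]
  | succ n ih => simp [newtQ, map_divByMonic _ (monic_X_sub_C _), ih]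

open Polynomial in
lemma newtQ_eval_map {R S : Type*} [CommRing R] [CommRing S] (φ : R →+* S) (z : ℕ → R) (f : R[X])
    (n : ℕ) : φ ((newtQ z f n).eval (z n)) =
      (newtQ (fun i => φ (z i)) (f.map φ) n).eval (φ (z n)) := by
  rw [← newtQ_map, eval_map_apply]

open Polynomial in
lemma newtQ_one {R : Type*} [CommRing R] (w k : ℕ) :
    (newtQ (fun _ => (1 : R)) (X ^ w) k).eval 1 = (w.choose k : R) := by
  have h := newtQ_sum (fun _ => (1 : R)) (X ^ w) (k + 1)
  have h2 := congrArg (fun q => (q.comp (X + 1)).coeff k) h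
  simp only [Polynomial.pow_comp, X_comp, coeff_X_add_one_pow] at h2
  rw [h2]
  simp only [add_comp, Polynomial.sum_comp, Polynomial.mul_comp, C_comp, Finset.prod_const,
    Finset.card_range, Polynomial.pow_comp, sub_comp, X_comp, map_one, one_comp, add_sub_cancel_right,
    coeff_add, finsetSum_coeff, Polynomial.coeff_mul_X_pow']
  rw [Finset.sum_eq_single k]
  · simp
  · intro l hl hlk
    have := Finset.mem_range.1 hl
    rw [if_pos (by omega), coeff_C, if_neg (by omega)]
  · simp

open Polynomial in
/-- generalized Vandermonde determinant at roots of unity of prime power order. -/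
lemma det_ne_zero_of_choose {p k L : ℕ} (hp : p.Prime) {ζ : ℂ} (hζ : IsPrimitiveRoot ζ (p ^ (k + 1)))
    (w : Fin L → ℕ) (s : ℕ → ℕ) (hs : ∀ i < L, ∀ j < L, ζ ^ s i = ζ ^ s j → i = j)
    (hD : ¬ ((p : ℤ) ∣ (Matrix.of fun i j : Fin L => ((w i).choose j : ℤ)).det)) :
    (Matrix.of fun i j : Fin L => (ζ ^ s j) ^ w i).det ≠ 0 := by
  have := Fact.mk hp
  let z : ℕ → ℤ[X] := fun i => X ^ s i
  let H : Matrix (Fin L) (Fin L) ℤ[X] := Matrix.of fun i j => (newtQ z (X ^ w i) j).eval (z j)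
  let φ : ℤ[X] →+* ℂ := (aeval ζ : ℤ[X] →ₐ[ℤ] ℂ).toRingHom
  have hφz : ∀ i, φ (z i) = ζ ^ s i := by intro i; simp [φ, z]
  let N : Matrix (Fin L) (Fin L) ℂ :=
    Matrix.of fun k j => ∏ i ∈ Finset.range k, (ζ ^ s j - ζ ^ s i)
  have hfac : (Matrix.of fun i j : Fin L => (ζ ^ s j) ^ w i) = φ.mapMatrix H * N := by
    ext i j
    have h := newtQ_sum (fun i => φ (z i)) (X ^ w i) L
    have h2 := congrArg (eval (ζ ^ s j)) h
    have h0 : ∏ i ∈ Finset.range L, (ζ ^ s j - ζ ^ s i) = 0 :=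
      Finset.prod_eq_zero (Finset.mem_range.2 j.2) (by simp)
    simp only [eval_add, eval_mul, eval_finsetSum, eval_prod, eval_sub, eval_X, eval_C, hφz, h0,
      mul_zero, add_zero, eval_pow] at h2
    rw [Matrix.of_apply, h2, Matrix.mul_apply, Finset.sum_range]
    refine Finset.sum_congr rfl fun l _ => ?_
    simp only [RingHom.mapMatrix_apply, Matrix.map_apply, H, Matrix.of_apply, N]
    rw [newtQ_eval_map]
    simp [hφz]
  have hN : N.det ≠ 0 := by
    rw [Matrix.det_of_isUpperTriangular]
    · rw [Finset.prod_ne_zero_iff]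
      intro i _
      simp only [N, Matrix.of_apply]
      rw [Finset.prod_ne_zero_iff]
      intro l hl h
      have hl' := Finset.mem_range.1 hl
      have := hs i i.2 l (by omega) (sub_eq_zero.1 h)
      omega
    · intro i j hij
      exact Finset.prod_eq_zero (Finset.mem_range.2 hij) (by simp)
  rw [hfac, Matrix.det_mul, ← RingHom.map_det]
  refine mul_ne_zero ?_ hN
  intro h0
  have hpos : 0 < p ^ (k + 1) := pow_pos hp.pos _
  have hdvd : cyclotomic (p ^ (k+1)) ℤ ∣ H.det := by
    rw [cyclotomic_eq_minpoly hζ hpos]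
    exact minpoly.isIntegrallyClosed_dvd (hζ.isIntegral hpos) h0
  have h1 : (p : ℤ) ∣ eval 1 H.det := by
    have := eval_dvd (x := 1) hdvd
    rwa [eval_one_cyclotomic_prime_pow] at this
  apply hD
  convert h1 using 1
  rw [← coe_evalRingHom, RingHom.map_det]
  congr 1
  ext i j
  simp only [RingHom.mapMatrix_apply, Matrix.map_apply, H, Matrix.of_apply]
  rw [newtQ_eval_map]
  simp [z, newtQ_one]


lemma vand_choose {n : ℕ} (v : Fin n → ℕ) :
    (Matrix.vandermonde fun i => (v i : ℤ)).det =
    ((∏ i : Fin n, Nat.factorial i : ℕ) : ℤ) *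
      (Matrix.of fun i j : Fin n => (Nat.choose (v i) j : ℤ)).det := by
  rw [Matrix.det_eval_matrixOfPolynomials_eq_det_vandermonde (fun i ↦ (v i : ℤ))
      (fun i => descPochhammer ℤ i)
      (fun i => descPochhammer_natDegree ℤ i)
      (fun i => monic_descPochhammer ℤ i)]
  convert! Matrix.det_mul_row (fun (i : Fin n) => ((Nat.factorial (i : ℕ)) : ℤ)) _
  · rw [Matrix.of_apply, descPochhammer_eval_eq_descFactorial ℤ _ _]
    congr
    exact Nat.descFactorial_eq_factorial_mul_choose _ _
  · rw [Nat.cast_prod]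

lemma choose_id_det (n : ℕ) :
    (Matrix.of fun i j : Fin n => (Nat.choose (i : ℕ) j : ℤ)).det = 1 := by
  rw [Matrix.det_of_isLowerTriangular]
  · simp
  · intro i j hij
    have : (i : ℕ) < j := hij
    simp [Nat.choose_eq_zero_of_lt this]

lemma vand_sq {n : ℕ} (v : Fin n → ℕ) :
    (Matrix.vandermonde fun i => (v i : ℤ)).det.natAbs ^ 2 =
      ∏ x ∈ (Finset.univ : Finset (Fin n)).offDiag, ((v x.1 : ℤ) - v x.2).natAbs := by
  have h := Finset.prod_prod_Ioi_mul_eq_prod_prod_off_diag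
    (fun i j : Fin n => ((v i : ℤ) - v j).natAbs)
  have h2 : ∏ x ∈ (Finset.univ : Finset (Fin n)).offDiag, ((v x.1 : ℤ) - v x.2).natAbs
      = ∏ i : Fin n, ∏ j ∈ ({i}ᶜ : Finset (Fin n)), ((v j : ℤ) - v i).natAbs := by
    rw [Finset.prod_sigma']
    refine Finset.prod_bij' (fun x _ => ⟨x.2, x.1⟩) (fun x _ => (x.2, x.1)) ?_ ?_ ?_ ?_ ?_ <;>
      simp [Finset.mem_offDiag]
  rw [h2, ← h, Matrix.det_vandermonde, ← Int.natAbsHom_apply, map_prod, ← Finset.prod_pow]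
  refine Finset.prod_congr rfl fun i _ => ?_
  rw [map_prod, ← Finset.prod_pow]
  refine Finset.prod_congr rfl fun j _ => ?_
  rw [Int.natAbsHom_apply, sq, ← Int.natAbs_neg ((v i : ℤ) - v j), neg_sub]

/-- ordered off-diagonal pairs congruent mod q -/
def prs {n : ℕ} (v : Fin n → ℕ) (q : ℕ) : Finset (Fin n × Fin n) :=
  (Finset.univ : Finset (Fin n)).offDiag.filter fun x => v x.1 % q = v x.2 % q

lemma prs_card {n : ℕ} (v : Fin n → ℕ) (q : ℕ) (hq : 0 < q) :
    (prs v q).card + n =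
      ∑ c ∈ Finset.range q, (Finset.univ.filter fun i : Fin n => v i % q = c).card ^ 2 := by
  have h1 : (prs v q).card + n =
      ((Finset.univ : Finset (Fin n × Fin n)).filter fun x => v x.1 % q = v x.2 % q).card := by
    have : ((Finset.univ : Finset (Fin n × Fin n)).filter fun x => v x.1 % q = v x.2 % q)
        = prs v q ∪ (Finset.univ : Finset (Fin n)).diag := by
      ext ⟨a, b⟩
      simp only [Finset.mem_filter, Finset.mem_univ, true_and, prs, Finset.mem_union,
        Finset.mem_offDiag, Finset.mem_diag]
      by_cases hab : a = b <;> simp [hab]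
    rw [this, Finset.card_union_of_disjoint, Finset.diag_card]
    · simp
    · rw [Finset.disjoint_left]
      rintro ⟨a, b⟩ h h'
      simp [prs] at h h'
      exact h.1 h'
  rw [h1, Finset.card_eq_sum_card_fiberwise (f := fun x => v x.1 % q) (t := Finset.range q)]
  · refine Finset.sum_congr rfl fun c _ => ?_
    rw [sq, ← Finset.card_product]
    congr 1
    ext ⟨a, b⟩
    simp only [Finset.mem_filter, Finset.mem_univ, true_and, Finset.mem_product]
    constructor
    · rintro ⟨h, h'⟩; exact ⟨h', by omega⟩
    · rintro ⟨h, h'⟩; exact ⟨by omega, h⟩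
  · intro x _
    simpa using Nat.mod_lt _ hq

lemma sum_card {n : ℕ} (v : Fin n → ℕ) (q : ℕ) (hq : 0 < q) :
    n = ∑ c ∈ Finset.range q, (Finset.univ.filter fun i : Fin n => v i % q = c).card := by
  have := Finset.card_eq_sum_card_fiberwise (s := (Finset.univ : Finset (Fin n)))
    (f := fun x => v x % q) (t := Finset.range q) (by
      intro x _
      simpa using Nat.mod_lt _ hq)
  simpa using this

lemma prs_le {n : ℕ} (v u : Fin n → ℕ) (q : ℕ) (hq : 0 < q)
    (hv : ∀ c < q, (Finset.univ.filter fun i : Fin n => v i % q = c).card = n / q ∨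
      (Finset.univ.filter fun i : Fin n => v i % q = c).card = (n + q - 1) / q) :
    (prs v q).card ≤ (prs u q).card := by
  have hv' : ∀ c < q, (Finset.univ.filter fun i : Fin n => v i % q = c).card = n / q ∨
      (Finset.univ.filter fun i : Fin n => v i % q = c).card = n / q + 1 := by
    intro c hc
    rcases hv c hc with h | h
    · exact Or.inl h
    · have h1 : n / q ≤ (n + q - 1) / q := Nat.div_le_div_right (by omega)
      have h2 : (n + q - 1) / q ≤ n / q + 1 := by
        rw [← Nat.add_div_right _ hq]; exact Nat.div_le_div_right (by omega)
      omega
  set a := n / q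
  have key : ∀ w : Fin n → ℕ, ((prs w q).card : ℤ) + n = (2 * a + 1) * n - a * (a + 1) * q +
      ∑ c ∈ Finset.range q, (((Finset.univ.filter fun i : Fin n => w i % q = c).card : ℤ) - a) *
        (((Finset.univ.filter fun i : Fin n => w i % q = c).card : ℤ) - (a + 1)) := by
    intro w
    have e1 := prs_card w q hq
    have e2 := sum_card w q hq
    have e1' : ((prs w q).card : ℤ) + n = ∑ c ∈ Finset.range q,
        ((Finset.univ.filter fun i : Fin n => w i % q = c).card : ℤ) ^ 2 := by exact_mod_cast e1
    have e2' : (n : ℤ) = ∑ c ∈ Finset.range q,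
        ((Finset.univ.filter fun i : Fin n => w i % q = c).card : ℤ) := by exact_mod_cast e2
    rw [e1']
    have : ∀ x : ℤ, (x - a) * (x - (a + 1)) = x ^ 2 - (2 * a + 1) * x + a * (a + 1) := by
      intro x; ring
    simp only [this, Finset.sum_add_distrib, Finset.sum_sub_distrib, ← Finset.mul_sum]
    rw [← e2']
    simp
    ring
  have k1 := key v
  have k2 := key u
  have z1 : ∑ c ∈ Finset.range q, (((Finset.univ.filter fun i : Fin n => v i % q = c).card : ℤ) - a) *
        (((Finset.univ.filter fun i : Fin n => v i % q = c).card : ℤ) - (a + 1)) = 0 := by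
    refine Finset.sum_eq_zero fun c hc => ?_
    rcases hv' c (Finset.mem_range.1 hc) with h | h <;> rw [h] <;> push_cast <;> ring
  have z2 : 0 ≤ ∑ c ∈ Finset.range q, (((Finset.univ.filter fun i : Fin n => u i % q = c).card : ℤ) - a) *
        (((Finset.univ.filter fun i : Fin n => u i % q = c).card : ℤ) - (a + 1)) := by
    refine Finset.sum_nonneg fun c hc => ?_
    generalize ((Finset.univ.filter fun i : Fin n => u i % q = c).card : ℤ) = x
    rcases le_or_gt x a with h | h
    · exact mul_nonneg_of_nonpos_of_nonpos (by linarith) (by linarith)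
    · exact mul_nonneg (by linarith) (by linarith [Int.add_one_le_iff.2 h])
  zify
  linarith

lemma fact_prod {n : ℕ} (v : Fin n → ℕ) (hv : Function.Injective v) {p B : ℕ} (hp : p.Prime)
    (hB : ∀ i, v i < p ^ B) :
    (∏ x ∈ (Finset.univ : Finset (Fin n)).offDiag, ((v x.1 : ℤ) - v x.2).natAbs).factorization p
      = ∑ t ∈ Finset.Ico 1 B, (prs v (p ^ t)).card := by
  have hne : ∀ x ∈ (Finset.univ : Finset (Fin n)).offDiag, ((v x.1 : ℤ) - v x.2).natAbs ≠ 0 := by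
    intro x hx
    have := hv.ne (Finset.mem_offDiag.1 hx).2.2
    omega
  rw [Nat.factorization_prod hne, Finsupp.finsetSum_apply]
  simp only [prs, Finset.card_filter]
  rw [Finset.sum_comm]
  refine Finset.sum_congr rfl fun x hx => ?_
  have h1 := hB x.1
  have h2 := hB x.2
  rw [Nat.factorization_eq_card_pow_dvd_of_lt hp (Nat.pos_of_ne_zero (hne x hx))
    (b := B) (by omega), Finset.card_filter]
  refine Finset.sum_congr rfl fun t _ => ?_
  congr 1
  rw [← Int.natCast_dvd, eq_iff_iff, ← Nat.ModEq, Nat.ModEq.comm, Nat.modEq_iff_dvd]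

lemma not_dvd_choose {n : ℕ} (v : Fin n → ℕ) (hv : Function.Injective v) {p k : ℕ} (hp : p.Prime)
    (hk : ∀ i, v i < p ^ k)
    (hu : ∀ t < k, ∀ c < p ^ t, (Finset.univ.filter fun i : Fin n => v i % p ^ t = c).card = n / p ^ t ∨
      (Finset.univ.filter fun i : Fin n => v i % p ^ t = c).card = (n + p ^ t - 1) / p ^ t) :
    ¬ ((p : ℤ) ∣ (Matrix.of fun i j : Fin n => ((v i).choose j : ℤ)).det) := by
  intro hdvd
  have hB : ∃ B, k ≤ B ∧ n ≤ p ^ B :=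
    ⟨k + n, by omega, (Nat.lt_pow_self hp.one_lt).le.trans (Nat.pow_le_pow_right hp.pos (by omega))⟩
  obtain ⟨B, hkB, hnB⟩ := hB
  have e1 := vand_sq v
  have e2 := vand_sq (fun i : Fin n => (i : ℕ))
  have f1 := fact_prod v hv hp (B := B) fun i =>
    (hk i).trans_le (Nat.pow_le_pow_right hp.pos hkB)
  have f2 := fact_prod (fun i : Fin n => (i : ℕ)) Fin.val_injective hp (B := B) fun i =>
    i.2.trans_le hnB
  rw [← e1] at f1
  rw [← e2] at f2
  rw [vand_choose] at f1 f2
  rw [choose_id_det, mul_one] at f2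
  have hV : (Matrix.vandermonde fun i => (v i : ℤ)).det ≠ 0 := by
    rw [Matrix.det_vandermonde_ne_zero_iff]
    intro i j h
    exact hv (Int.ofNat_inj.1 h)
  rw [vand_choose] at hV
  set D := (Matrix.of fun i j : Fin n => ((v i).choose j : ℤ)).det
  have hD : D.natAbs ≠ 0 := by
    simpa using right_ne_zero_of_mul hV
  have hF : (∏ i : Fin n, Nat.factorial i) ≠ 0 :=
    Finset.prod_ne_zero_iff.2 fun i _ => Nat.factorial_ne_zero _
  rw [Int.natAbs_mul, Int.natAbs_natCast, mul_pow, Nat.factorization_mul (pow_ne_zero _ hF)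
    (pow_ne_zero _ hD)] at f1
  rw [Int.natAbs_natCast] at f2
  have hle : ∑ t ∈ Finset.Ico 1 B, (prs v (p ^ t)).card ≤
      ∑ t ∈ Finset.Ico 1 B, (prs (fun i : Fin n => (i : ℕ)) (p ^ t)).card := by
    refine Finset.sum_le_sum fun t _ => ?_
    rcases lt_or_ge t k with ht | ht
    · exact prs_le _ _ _ (pow_pos hp.pos _) (hu t ht)
    · have : prs v (p ^ t) = ∅ := by
        rw [prs, Finset.filter_eq_empty_iff]
        rintro ⟨i, j⟩ hx
        have hl : p ^ k ≤ p ^ t := Nat.pow_le_pow_right hp.pos ht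
        rw [Nat.mod_eq_of_lt ((hk i).trans_le hl), Nat.mod_eq_of_lt ((hk j).trans_le hl)]
        exact hv.ne (Finset.mem_offDiag.1 hx).2.2
      simp [this]
  have hpos : 0 < (D.natAbs ^ 2).factorization p := by
    refine hp.factorization_pos_of_dvd (pow_ne_zero _ hD) ?_
    exact dvd_pow (Int.natCast_dvd.1 hdvd) two_ne_zero
  rw [Finsupp.add_apply] at f1
  omega

def GoodW (m : ℕ) (W : Finset (ZMod m)) : Prop :=
  ∀ S : Finset ℂ, (∀ z ∈ S, z ^ m = 1) → S.card ≤ W.card → ∀ g : ℂ → ℂ,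
    (∀ r ∈ W, ∑ z ∈ S, g z * z ^ r.val = 0) → ∀ z ∈ S, g z = 0

lemma goodW_of_det {m : ℕ} [NeZero m] (W : Finset (ZMod m)) {L : ℕ} (hL : W.card = L)
    (w : Fin L → ZMod m) (hw : ∀ i, w i ∈ W)
    (h : ∀ z : Fin L → ℂ, Function.Injective z → (∀ i, z i ^ m = 1) →
      (Matrix.of fun i j : Fin L => z j ^ (w i).val).det ≠ 0) : GoodW m W := by
  intro S hS hcard g hg
  have hsub : S ⊆ Polynomial.nthRootsFinset m (1 : ℂ) := by
    intro z hz
    rw [Polynomial.mem_nthRootsFinset (NeZero.pos m)]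
    exact hS z hz
  have hle : L ≤ (Polynomial.nthRootsFinset m (1 : ℂ)).card := by
    rw [(Complex.isPrimitiveRoot_exp m (NeZero.ne m)).card_nthRootsFinset, ← hL]
    simpa using Finset.card_le_univ W
  obtain ⟨T, hST, hT, hTc⟩ := Finset.exists_subsuperset_card_eq hsub (hcard.trans hL.le) hle
  let e := T.equivFinOfCardEq hTc
  let z : Fin L → ℂ := fun i => (e.symm i : ℂ)
  have hz : Function.Injective z := Subtype.val_injective.comp e.symm.injective
  have hz1 : ∀ i, z i ^ m = 1 := fun i => by
    have := hT (e.symm i).2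
    rwa [Polynomial.mem_nthRootsFinset (NeZero.pos m)] at this
  classical
  have key := Matrix.eq_zero_of_mulVec_eq_zero (h z hz hz1)
    (v := fun j => if z j ∈ S then g (z j) else 0) (by
      ext i
      have h1 := hg (w i) (hw i)
      simp only [Matrix.mulVec, dotProduct, Matrix.of_apply, Pi.zero_apply]
      have h2 : ∑ x ∈ S, g x * x ^ (w i).val =
          ∑ x ∈ T, x ^ (w i).val * (if x ∈ S then g x else 0) := by
        rw [← Finset.sum_subset hST]
        · refine Finset.sum_congr rfl fun x hx => ?_
          simp [hx, mul_comm]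
        · intro x _ hx
          simp [hx]
      rw [h2, ← Finset.sum_coe_sort T] at h1
      refine Eq.trans ?_ h1
      exact e.symm.sum_comp (fun x : T => (x : ℂ) ^ (w i).val * (if (x : ℂ) ∈ S then g x else 0)))
  intro x hx
  have := congrFun key (e ⟨x, hST hx⟩)
  simpa [z, hx] using this

lemma goodW_initial {m L : ℕ} [NeZero m] (W : Finset (ZMod m)) (hW : W.card = L) (hL : L < m)
    (h : ∀ x : ZMod m, x ∈ W ↔ x.val < L) : GoodW m W := by
  have hv : ∀ i : Fin L, ((i : ℕ) : ZMod m).val = i := fun i =>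
    ZMod.val_natCast_of_lt (i.2.trans hL)
  refine goodW_of_det W hW (fun i => ((i : ℕ) : ZMod m)) (fun i => ?_) ?_
  · rw [h, hv]; exact i.2
  · intro z hz _
    have : (Matrix.of fun i j : Fin L => z j ^ ((i : ℕ) : ZMod m).val) = (Matrix.vandermonde z)ᵀ := by
      ext i j
      simp [Matrix.vandermonde_apply, hv]
    rw [this, Matrix.det_transpose, Matrix.det_vandermonde_ne_zero_iff]
    exact hz


lemma mem_coset_iff {m n c : ℕ} [NeZero m] (hn : n ∣ m) (hc : c < n) (x : ZMod m) :
    x - (c : ZMod m) ∈ AddSubgroup.zmultiples ((n : ZMod m)) ↔ x.val % n = c := by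
  rw [AddSubgroup.mem_zmultiples_iff]
  constructor
  · rintro ⟨k, hk⟩
    have h := congrArg (ZMod.castHom hn (ZMod n)) hk
    rw [map_zsmul, map_sub, map_natCast, map_natCast, ZMod.natCast_self, smul_zero, eq_comm,
      sub_eq_zero, ← ZMod.natCast_zmod_val x, map_natCast, ZMod.natCast_eq_natCast_iff'] at h
    rwa [Nat.mod_eq_of_lt hc] at h
  · intro h
    refine ⟨(x.val / n : ℕ), ?_⟩
    have h1 := Nat.mod_add_div x.val n
    rw [h] at h1
    have h2 := congrArg (Nat.cast : ℕ → ZMod m) h1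
    rw [ZMod.natCast_zmod_val] at h2
    conv_rhs => rw [← h2]
    rw [natCast_zsmul, nsmul_eq_mul, Nat.cast_add, Nat.cast_mul, add_sub_cancel_left, mul_comm]

lemma goodW_unif {m : ℕ} [NeZero m] (W : Finset (ZMod m)) (hm : IsPrimePow m)
    (h : UnifDist m W) : GoodW m W := by
  obtain ⟨p, k, hp, hk, rfl⟩ := (isPrimePow_nat_iff _).1 hm
  obtain ⟨k, rfl⟩ : ∃ l, k = l + 1 := ⟨k - 1, by omega⟩
  let e := W.equivFin.symm
  refine goodW_of_det W rfl (fun i => (e i : ZMod _)) (fun i => (e i).2) ?_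
  intro z hz hz1
  have hζ := Complex.isPrimitiveRoot_exp (p ^ (k + 1)) (NeZero.ne _)
  set ζ := Complex.exp (2 * ↑Real.pi * Complex.I / ↑(p ^ (k + 1)))
  choose s hs using fun i => hζ.eq_pow_of_pow_eq_one (hz1 i)
  let s' : ℕ → ℕ := fun i => if h : i < W.card then s ⟨i, h⟩ else 0
  have hs' : ∀ i : Fin W.card, ζ ^ s' i = z i := by
    intro i
    simp [s', (hs i).2]
  have hinj : Function.Injective fun i => (e i : ZMod (p ^ (k+1))).val :=
    (ZMod.val_injective _).comp (Subtype.val_injective.comp e.injective)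
  have := det_ne_zero_of_choose hp hζ (fun i => (e i : ZMod (p ^ (k+1))).val) s' (by
    intro i hi j hj hij
    have h1 := hs' ⟨i, hi⟩
    have h2 := hs' ⟨j, hj⟩
    simp only at h1 h2
    have := hz (h1.symm.trans (hij.trans h2))
    simpa using this) (by
    refine not_dvd_choose _ hinj (k := k + 1) hp (fun i => ZMod.val_lt _) ?_
    intro t ht c hc
    have hn : p ^ t ∣ p ^ (k + 1) := pow_dvd_pow _ (by omega)
    have hu := h (p ^ t) hn (c : ZMod (p ^ (k+1)))
    have hcard : {x : ZMod (p ^ (k+1)) | x ∈ W ∧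
        x - (c : ZMod (p ^ (k+1))) ∈ AddSubgroup.zmultiples (((p ^ t : ℕ) : ZMod (p ^ (k+1))))}.ncard
        = (Finset.univ.filter fun i => (e i : ZMod (p ^ (k+1))).val % p ^ t = c).card := by
      simp only [mem_coset_iff hn hc]
      rw [← Finset.card_image_of_injective (f := fun i => (e i : ZMod (p ^ (k+1)))) _
        (Subtype.val_injective.comp e.injective), ← Set.ncard_coe_finset]
      congr 1
      ext x
      simp only [Set.mem_ofPred_eq, Finset.coe_image, Finset.coe_filter, Finset.mem_univ, true_and,
        Set.mem_image]
      constructor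
      · rintro ⟨hx, hx'⟩
        exact ⟨e.symm ⟨x, hx⟩, by simpa using hx', by simp⟩
      · rintro ⟨i, hi, rfl⟩
        exact ⟨(e i).2, hi⟩
    rw [hcard] at hu
    exact hu)
  simpa only [hs'] using this

lemma unif_of_prime {m : ℕ} [NeZero m] (W : Finset (ZMod m)) (hm : m.Prime) (hL : W.card < m) :
    UnifDist m W := by
  intro n hn c
  rcases (Nat.dvd_prime hm).1 hn with rfl | rfl
  · left
    have : {x : ZMod m | x ∈ W ∧ x - c ∈ AddSubgroup.zmultiples (((1 : ℕ) : ZMod m))} = W := by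
      ext x
      simp only [Set.mem_ofPred_eq, Finset.mem_coe, and_iff_left_iff_imp]
      intro _
      rw [AddSubgroup.mem_zmultiples_iff]
      exact ⟨((x - c).val : ℕ), by simp⟩
    rw [this, Set.ncard_coe_finset, Nat.div_one]
  · have hsub : {x : ZMod n | x ∈ W ∧ x - c ∈ AddSubgroup.zmultiples ((n : ZMod n))} ⊆
        ({c} : Set (ZMod n)) := by
      rintro x ⟨_, hx⟩
      simpa [sub_eq_zero] using hx
    have h1 := Set.ncard_le_ncard hsub
    rw [Set.ncard_singleton] at h1
    rw [Nat.div_eq_of_lt hL]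
    rcases Nat.eq_zero_or_pos W.card with h0 | h0
    · left
      rw [Finset.card_eq_zero] at h0
      simp [h0]
    · have : (W.card + n - 1) / n = 1 := by
        rw [Nat.div_eq_iff (NeZero.pos n)]
        omega
      omega

lemma hatKer_eq (d : ℕ) [NeZero d] (a : ZMod d → ℂ) (j : ZMod d) :
    hatKer d a j = ∑ k : ZMod d, a k * ZMod.stdAddChar (-(j * k)) := by
  unfold hatKer
  refine Finset.sum_congr rfl fun k _ => ?_
  congr 1
  have : -(j * k) = ((-((j.val : ℤ) * (k.val : ℤ)) : ℤ) : ZMod d) := by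
    push_cast
    simp
  rw [this, ZMod.stdAddChar_coe]
  congr 1
  push_cast
  ring

lemma conv_char (d : ℕ) [NeZero d] (a : ZMod d → ℂ) (j : ZMod d) :
    convMat d a *ᵥ (fun k => (ZMod.stdAddChar (j * k) : ℂ)) =
      hatKer d a j • (fun k => (ZMod.stdAddChar (j * k) : ℂ)) := by
  ext k
  simp only [Matrix.mulVec, dotProduct, convMat, Matrix.of_apply, Pi.smul_apply, smul_eq_mul]
  rw [hatKer_eq, Finset.sum_mul, ← (Equiv.subLeft k).sum_comp]
  refine Finset.sum_congr rfl fun l _ => ?_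
  simp only [Equiv.subLeft_apply, sub_sub_cancel]
  rw [mul_assoc, ← AddChar.map_add_eq_mul]
  congr 2
  ring

lemma conv_pow_char (d : ℕ) [NeZero d] (a : ZMod d → ℂ) (j : ZMod d) (n : ℕ) :
    convMat d a ^ n *ᵥ (fun k => (ZMod.stdAddChar (j * k) : ℂ)) =
      hatKer d a j ^ n • (fun k => (ZMod.stdAddChar (j * k) : ℂ)) := by
  induction n with
  | zero => simp
  | succ n ih =>
    rw [pow_succ, ← Matrix.mulVec_mulVec, conv_char, Matrix.mulVec_smul, ih, smul_smul, pow_succ,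
      mul_comm]

lemma single_eq (d : ℕ) [NeZero d] (i : ZMod d) :
    (Pi.single i 1 : ZMod d → ℂ) = (d : ℂ)⁻¹ • ∑ j : ZMod d,
      (ZMod.stdAddChar (-(i * j)) : ℂ) • (fun k => (ZMod.stdAddChar (j * k) : ℂ)) := by
  ext k
  have h := AddChar.sum_mulShift (k - i) (ZMod.isPrimitive_stdAddChar d)
  have hd : (d : ℂ) ≠ 0 := by exact_mod_cast NeZero.ne d
  have e : ∑ j : ZMod d, (ZMod.stdAddChar (-(i * j)) : ℂ) * ZMod.stdAddChar (j * k) =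
      ∑ j : ZMod d, (ZMod.stdAddChar (j * (k - i)) : ℂ) := by
    refine Finset.sum_congr rfl fun j _ => ?_
    rw [← AddChar.map_add_eq_mul]
    congr 1
    ring
  simp only [Pi.smul_apply, Finset.sum_apply, smul_eq_mul]
  rw [e, h]
  by_cases hk : k = i
  · subst hk
    simp [hd, ZMod.card]
  · simp [hk, sub_eq_zero]

lemma frame_of_good (d m J L : ℕ) [NeZero d] [NeZero m] (hd : d = m * J)
    (W : Finset (ZMod m)) (hW : W.card = L) (hg : GoodW m W) (a : ZMod d → ℂ)
    (ha : maxMultB d m J (hatKer d a) = L) :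
    Submodule.span ℂ {v : ZMod d → ℂ | ∃ i : ZMod d, ((i.val : ZMod m) ∈ W) ∧
      ∃ n ≤ m - 1, v = (convMat d a) ^ n *ᵥ (Pi.single i 1 : ZMod d → ℂ)} = ⊤ := by
  by_contra hne
  obtain ⟨f, hf0, hf⟩ := Submodule.exists_le_ker_of_lt_top _ (lt_top_iff_ne_top.2 hne)
  have hmpos : 0 < m := NeZero.pos m
  have hJpos : 0 < J := by
    rcases Nat.eq_zero_or_pos J with h | h
    · exact absurd (by rw [hd, h, mul_zero]) (NeZero.ne d)
    · exact h
  have hdC : (d : ℂ) ≠ 0 := by exact_mod_cast NeZero.ne d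
  set χ : AddChar (ZMod d) ℂ := ZMod.stdAddChar with hχ
  have hχinj : Function.Injective χ := ZMod.injective_stdAddChar
  set b := hatKer d a with hb
  let G : ZMod d → ℂ := fun j => f (fun k => χ (j * k))
  have hE : ∀ i : ZMod d, (i.val : ZMod m) ∈ W → ∀ n ≤ m - 1,
      ∑ j, χ (-(i * j)) * (b j ^ n * G j) = 0 := by
    intro i hi n hn
    have h1 : f ((convMat d a) ^ n *ᵥ (Pi.single i 1 : ZMod d → ℂ)) = 0 :=
      hf (Submodule.subset_span ⟨i, hi, n, hn, rfl⟩)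
    rw [single_eq, Matrix.mulVec_smul, Matrix.mulVec_sum, map_smul, map_sum, smul_eq_mul] at h1
    have h2 := (mul_eq_zero.1 h1).resolve_left (inv_ne_zero hdC)
    rw [← h2]
    refine Finset.sum_congr rfl fun j _ => ?_
    rw [Matrix.mulVec_smul, conv_pow_char, map_smul, map_smul, smul_eq_mul, smul_eq_mul]
  have hP : ∀ i : ZMod d, (i.val : ZMod m) ∈ W → ∀ q : Polynomial ℂ, q.natDegree < m →
      ∑ j, χ (-(i * j)) * (q.eval (b j) * G j) = 0 := by
    intro i hi q hq
    have : ∀ j, χ (-(i * j)) * (q.eval (b j) * G j) =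
        ∑ n ∈ Finset.range m, q.coeff n * (χ (-(i * j)) * (b j ^ n * G j)) := by
      intro j
      rw [Polynomial.eval_eq_sum_range' hq, Finset.sum_mul, Finset.mul_sum]
      refine Finset.sum_congr rfl fun n _ => ?_
      ring
    simp only [this]
    rw [Finset.sum_comm]
    refine Finset.sum_eq_zero fun n hn => ?_
    rw [← Finset.mul_sum, hE i hi n (by have := Finset.mem_range.1 hn; omega), mul_zero]
  have hG : ∀ j0, G j0 = 0 := by
    intro j0
    classical
    let T : Finset (ZMod d) := Finset.univ.filter fun j => (m : ZMod d) * (j - j0) = 0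
    have hgeo : ∀ x : ZMod d, ∑ t ∈ Finset.range J, χ (t • ((m : ZMod d) * x)) =
        if (m : ZMod d) * x = 0 then (J : ℂ) else 0 := by
      intro x
      simp only [AddChar.map_nsmul_eq_pow]
      split_ifs with hx
      · simp [hx]
      · have h1 : χ ((m : ZMod d) * x) ≠ 1 := by
          intro h
          apply hx
          apply hχinj
          rw [h, AddChar.map_zero_eq_one]
        have h2 : χ ((m : ZMod d) * x) ^ J = 1 := by
          rw [← AddChar.map_nsmul_eq_pow, nsmul_eq_mul, ← mul_assoc, ← Nat.cast_mul, mul_comm J,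
            ← hd, ZMod.natCast_self, zero_mul, AddChar.map_zero_eq_one]
        rw [geom_sum_eq h1, h2, sub_self, zero_div]
    have hTq : ∀ r ∈ W, ∀ q : Polynomial ℂ, q.natDegree < m →
        ∑ j ∈ T, χ (-((r.val : ZMod d) * j)) * (q.eval (b j) * G j) = 0 := by
      intro r hr q hq
      have h1 : ∀ t ∈ Finset.range J, χ (t • ((m : ZMod d) * j0)) * ∑ j,
          χ (-(((r.val + m * t : ℕ) : ZMod d) * j)) * (q.eval (b j) * G j) = 0 := by
        intro t _
        rw [hP _ _ q hq, mul_zero]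
        have : (((r.val + m * t : ℕ) : ZMod d).val : ZMod m) = r := by
          rw [ZMod.val_natCast]
          have h2 : (((r.val + m * t) % d : ℕ) : ZMod m) = ((r.val : ℕ) : ZMod m) := by
            rw [ZMod.natCast_eq_natCast_iff', Nat.mod_mod_of_dvd _ ⟨J, hd⟩]
            simp
          rw [h2, ZMod.natCast_zmod_val]
        rw [this]; exact hr
      have h2 := Finset.sum_eq_zero h1
      simp only [Finset.mul_sum] at h2
      rw [Finset.sum_comm] at h2
      have h3 : ∀ j, ∑ t ∈ Finset.range J, χ (t • ((m : ZMod d) * j0)) *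
          (χ (-(((r.val + m * t : ℕ) : ZMod d) * j)) * (q.eval (b j) * G j)) =
          if (m : ZMod d) * (j - j0) = 0 then
            (J : ℂ) * (χ (-((r.val : ZMod d) * j)) * (q.eval (b j) * G j)) else 0 := by
        intro j
        have h4 := hgeo (j0 - j)
        have h5 : ((m : ZMod d) * (j0 - j) = 0) ↔ ((m : ZMod d) * (j - j0) = 0) := by
          rw [← neg_sub, mul_neg, neg_eq_zero]
        simp only [h5] at h4
        rw [← zero_mul (χ (-((r.val : ZMod d) * j)) * (q.eval (b j) * G j)), ← ite_mul, ← h4,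
          Finset.sum_mul]
        refine Finset.sum_congr rfl fun t _ => ?_
        generalize q.eval (b j) * G j = y
        rw [← mul_assoc, ← mul_assoc, ← AddChar.map_add_eq_mul, ← AddChar.map_add_eq_mul]
        congr 2
        simp only [nsmul_eq_mul]
        push_cast
        ring
      simp only [h3] at h2
      rw [← Finset.sum_filter, ← Finset.mul_sum] at h2
      exact (mul_eq_zero.1 h2).resolve_left (by exact_mod_cast hJpos.ne')
    have hTs : ∀ j ∈ T, ∃ s < m, j = ((j0.val % J + s * J : ℕ) : ZMod d) := by
      intro j hj
      have h1 : (m : ZMod d) * (j - j0) = 0 := (Finset.mem_filter.1 hj).2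
      have h2 : ((m * j.val : ℕ) : ZMod d) = ((m * j0.val : ℕ) : ZMod d) := by
        push_cast
        rw [ZMod.natCast_zmod_val, ZMod.natCast_zmod_val]
        linear_combination h1
      rw [ZMod.natCast_eq_natCast_iff] at h2
      have h3 : j.val ≡ j0.val [MOD J] := by
        refine Nat.ModEq.mul_left_cancel' hmpos.ne' ?_
        rwa [← hd]
      refine ⟨j.val / J, ?_, ?_⟩
      · rw [Nat.div_lt_iff_lt_mul hJpos, ← hd]
        exact ZMod.val_lt j
      · rw [← h3, Nat.mod_add_div', ZMod.natCast_zmod_val]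
    let ι : ℕ → ZMod d := fun s => ((j0.val % J + s * J : ℕ) : ZMod d)
    have hTcard : T.card ≤ m := by
      have : T ⊆ (Finset.range m).image ι := by
        intro j hj
        obtain ⟨s, hs, h⟩ := hTs j hj
        exact Finset.mem_image.2 ⟨s, Finset.mem_range.2 hs, h.symm⟩
      simpa using (Finset.card_le_card this).trans Finset.card_image_le
    let S := T.filter fun j => b j = b j0
    have hj0T : j0 ∈ T := Finset.mem_filter.2 ⟨Finset.mem_univ _, by simp⟩
    have hj0S : j0 ∈ S := Finset.mem_filter.2 ⟨hj0T, rfl⟩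
    have hScard : S.card ≤ L := by
      have ht : j0.val / J < m := by
        rw [Nat.div_lt_iff_lt_mul hJpos, ← hd]
        exact ZMod.val_lt j0
      have hjt : ι (j0.val / J) = j0 := by
        simp only [ι]
        rw [Nat.mod_add_div', ZMod.natCast_zmod_val]
      have h1 : S ⊆ ((Finset.range m).filter fun s => b (ι s) = b (ι (j0.val / J))).image ι := by
        intro j hj
        obtain ⟨hjT, hjb⟩ := Finset.mem_filter.1 hj
        obtain ⟨s, hs, h⟩ := hTs j hjT
        refine Finset.mem_image.2 ⟨s, Finset.mem_filter.2 ⟨Finset.mem_range.2 hs, ?_⟩, h.symm⟩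
        rw [hjt, ← hjb, h]
      refine ((Finset.card_le_card h1).trans Finset.card_image_le).trans ?_
      rw [← ha, maxMultB]
      refine le_trans ?_ (Finset.le_sup (Finset.mem_range.2 (Nat.mod_lt j0.val hJpos)))
      refine le_trans ?_ (Finset.le_sup (Finset.mem_range.2 ht))
      rw [Nat.card_coe_set_eq, ← Set.ncard_coe_finset]
      refine le_of_eq ?_
      congr 1
      ext s
      simp [ι]
    have hS : ∀ r ∈ W, ∑ j ∈ S, χ (-((r.val : ZMod d) * j)) * G j = 0 := by
      intro r hr
      let q : Polynomial ℂ := ∏ l ∈ (T.image b).erase (b j0), (Polynomial.X - Polynomial.C l)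
      have hq : q.natDegree < m := by
        rw [Polynomial.natDegree_prod_of_monic _ _ fun l _ => Polynomial.monic_X_sub_C l]
        simp only [Polynomial.natDegree_X_sub_C, Finset.sum_const, smul_eq_mul, mul_one]
        have h1 : b j0 ∈ T.image b := Finset.mem_image_of_mem _ hj0T
        have h2 := Finset.card_erase_lt_of_mem h1
        exact h2.trans_le (Finset.card_image_le.trans hTcard)
      have hq0 : q.eval (b j0) ≠ 0 := by
        simp only [q, Polynomial.eval_prod, Finset.prod_ne_zero_iff, Polynomial.eval_sub,
          Polynomial.eval_X, Polynomial.eval_C]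
        intro l hl
        exact sub_ne_zero.2 (Finset.ne_of_mem_erase hl).symm
      have h1 := hTq r hr q hq
      have h2 : ∑ j ∈ T, χ (-((r.val : ZMod d) * j)) * (q.eval (b j) * G j) =
          q.eval (b j0) * ∑ j ∈ S, χ (-((r.val : ZMod d) * j)) * G j := by
        have h3 : ∑ j ∈ S, χ (-((r.val : ZMod d) * j)) * G j =
            ∑ j ∈ T, if b j = b j0 then χ (-((r.val : ZMod d) * j)) * G j else 0 :=
          Finset.sum_filter _ _
        rw [h3, Finset.mul_sum]
        refine Finset.sum_congr rfl fun j hj => ?_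
        split_ifs with hbj
        · rw [hbj]; ring
        · have : q.eval (b j) = 0 := by
            simp only [q, Polynomial.eval_prod]
            refine Finset.prod_eq_zero
              (Finset.mem_erase.2 ⟨hbj, Finset.mem_image_of_mem _ hj⟩) (by simp)
          rw [this]; ring
      rw [h2] at h1
      exact (mul_eq_zero.1 h1).resolve_left hq0
    let ψ : ZMod d → ℂ := fun j => χ (-(j - j0))
    have hψ : Function.Injective ψ := by
      intro x y h
      have := hχinj h
      simpa using this
    have hfin := hg (S.image ψ) (by
      intro z hz
      obtain ⟨j, hj, rfl⟩ := Finset.mem_image.1 hz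
      have h1 : (m : ZMod d) * (j - j0) = 0 :=
        (Finset.mem_filter.1 (Finset.mem_filter.1 hj).1).2
      simp only [ψ]
      rw [← AddChar.map_nsmul_eq_pow, nsmul_eq_mul, mul_neg, h1, neg_zero,
        AddChar.map_zero_eq_one])
      (by rw [Finset.card_image_of_injective _ hψ, hW]; exact hScard)
      (fun z => G (Function.invFun ψ z)) (by
        intro r hr
        rw [Finset.sum_image fun x _ y _ h => hψ h]
        have h1 := hS r hr
        have h2 : ∑ j ∈ S, G (Function.invFun ψ (ψ j)) * ψ j ^ r.val =
            χ ((r.val : ZMod d) * j0) * ∑ j ∈ S, χ (-((r.val : ZMod d) * j)) * G j := by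
          rw [Finset.mul_sum]
          refine Finset.sum_congr rfl fun j _ => ?_
          rw [Function.leftInverse_invFun hψ j, ← mul_assoc, ← AddChar.map_add_eq_mul, mul_comm]
          congr 1
          simp only [ψ]
          rw [← AddChar.map_nsmul_eq_pow, nsmul_eq_mul]
          congr 1
          ring
        rw [h2, h1, mul_zero]) (ψ j0) (Finset.mem_image_of_mem _ hj0S)
    simpa [Function.leftInverse_invFun hψ j0] using hfin
  apply hf0
  refine LinearMap.pi_ext' fun i => LinearMap.ext_ring ?_
  have h1 : f (Pi.single i 1 : ZMod d → ℂ) = 0 := by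
    rw [single_eq, map_smul, map_sum]
    refine smul_eq_zero_of_right _ (Finset.sum_eq_zero fun j _ => ?_)
    rw [map_smul]
    exact smul_eq_zero_of_right _ (hG j)
  simpa using h1


/-- with `d = mJ`, `m > 1`, `W ⊂ ℤ_m`, `|W| = L < m`,
`Ω = ∪_{r ∈ W} (mℤ_d + r)` and `Y = {A^n e_i : i ∈ Ω, n ≤ m - 1}`:
(1) if `W = {0, …, L-1}` then `Y` is a frame for every `A ∈ ℬ_L`;
(2) if `m` is prime then `Y` is a frame for every `A ∈ ℬ_L`;
(3) if `m` is a prime power and `W` is uniformly distributed over the divisors of `m`,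
then `Y` is a frame for every `A ∈ ℬ_L`. -/
theorem stmt11 (d m J L : ℕ) [NeZero d] [NeZero m] (hm : 1 < m) (hd : d = m * J)
    (W : Finset (ZMod m)) (hW : W.card = L) (hL : L < m) :
    ((∀ x : ZMod m, x ∈ W ↔ x.val < L) →
      ∀ a : ZMod d → ℂ, maxMultB d m J (hatKer d a) = L →
        Submodule.span ℂ {v : ZMod d → ℂ | ∃ i : ZMod d, ((i.val : ZMod m) ∈ W) ∧
          ∃ n ≤ m - 1, v = (convMat d a) ^ n *ᵥ (Pi.single i 1 : ZMod d → ℂ)} = ⊤) ∧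
    (Nat.Prime m →
      ∀ a : ZMod d → ℂ, maxMultB d m J (hatKer d a) = L →
        Submodule.span ℂ {v : ZMod d → ℂ | ∃ i : ZMod d, ((i.val : ZMod m) ∈ W) ∧
          ∃ n ≤ m - 1, v = (convMat d a) ^ n *ᵥ (Pi.single i 1 : ZMod d → ℂ)} = ⊤) ∧
    (IsPrimePow m → UnifDist m W →
      ∀ a : ZMod d → ℂ, maxMultB d m J (hatKer d a) = L →
        Submodule.span ℂ {v : ZMod d → ℂ | ∃ i : ZMod d, ((i.val : ZMod m) ∈ W) ∧
          ∃ n ≤ m - 1, v = (convMat d a) ^ n *ᵥ (Pi.single i 1 : ZMod d → ℂ)} = ⊤) := by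
  have main := fun hg a ha => frame_of_good d m J L hd W hW hg a ha
  refine ⟨fun h => main (goodW_initial W hW hL h), fun h => ?_, fun h h' => main (goodW_unif W h h')⟩
  exact main (goodW_unif W h.isPrimePow (unif_of_prime W h (hW ▸ hL)))
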